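/- arXiv:1310.2410 — 2 statements merged into one kernel-verified Lean document; each statement's English description precedes it below -/
import Mathlib

section
/- Let 0 < q < 1, let k be a positive integer, let s > 0, and let A ∈ ℝ^{n×p} with spectral norm σ(A). Let x ∈ ℝ^p be arbitrary, z ∈ ℝ^n with ‖Aᵀz‖_∞ ≤ ε, and y = Ax + z. Let η ≥ ε + σ(A)^2·‖x_{-max(k)}‖_2, and let x̂ be a minimizer of ‖w‖_q^q subject to ‖Aᵀ(y - Aw)‖_∞ ≤ η. If the ⌈(s^q+1)k⌉-order restricted isometry constant δ = δ_{(s^q+1)k} of A satisfies δ < 1/√(s^{q-2}+1), then ‖x̂ - x‖_2 ≤ √(2(s^q+1)k)·(ε+η)/(1 - √(s^{q-2}+1)·δ) + ( √(2(s^q+1)k)·σ(A)^2/(1 - √(s^{q-2}+1)·δ) + 1 )·‖x_{-max(k)}‖_2. -/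
open scoped BigOperators

/-- `‖v‖_q^q = ∑ |v i|^q` for `v ∈ ℝ^p`. -/
noncomputable def lqq (q : ℝ) {p : ℕ} (v : Fin p → ℝ) : ℝ := ∑ i, |v i| ^ q

/-- The `ℓ_q` quasinorm `(∑ |v i|^q)^(1/q)`. -/
noncomputable def lqNorm (q : ℝ) {p : ℕ} (v : Fin p → ℝ) : ℝ := (∑ i, |v i| ^ q) ^ (1/q)

/-- Euclidean norm on `ℝ^p`. -/
noncomputable def l2Norm {p : ℕ} (v : Fin p → ℝ) : ℝ := Real.sqrt (∑ i, (v i) ^ 2)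

/-- `ℓ_1` norm on `ℝ^p`. -/
noncomputable def l1Norm {p : ℕ} (v : Fin p → ℝ) : ℝ := ∑ i, |v i|

/-- `ℓ_∞` norm on `ℝ^p`. -/
noncomputable def linfNorm {p : ℕ} (v : Fin p → ℝ) : ℝ := ⨆ i, |v i|

open Classical in
/-- `‖v‖_0`: number of nonzero entries of `v`. -/
noncomputable def l0 {p : ℕ} (v : Fin p → ℝ) : ℕ := (Finset.univ.filter (fun i => v i ≠ 0)).card

/-- `v` is `k`-sparse if it has at most `k` nonzero entries. -/
def Sparse {p : ℕ} (k : ℕ) (v : Fin p → ℝ) : Prop := l0 v ≤ k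

/-- The `m`-order restricted isometry constant of `A`: the infimum of those `δ ≥ 0` such
that `(1-δ)‖x‖₂² ≤ ‖Ax‖₂² ≤ (1+δ)‖x‖₂²` for all `m`-sparse `x`. -/
noncomputable def ric {n p : ℕ} (A : Matrix (Fin n) (Fin p) ℝ) (m : ℕ) : ℝ :=
  sInf {δ : ℝ | 0 ≤ δ ∧ ∀ x : Fin p → ℝ, Sparse m x →
    (1 - δ) * (∑ i, (x i) ^ 2) ≤ (∑ i, (A.mulVec x i) ^ 2) ∧
    (∑ i, (A.mulVec x i) ^ 2) ≤ (1 + δ) * (∑ i, (x i) ^ 2)}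

/-- The spectral norm of `A`: the least `c ≥ 0` with `‖Av‖₂ ≤ c‖v‖₂` for all `v`. -/
noncomputable def specNorm {n p : ℕ} (A : Matrix (Fin n) (Fin p) ℝ) : ℝ :=
  sInf {c : ℝ | 0 ≤ c ∧ ∀ v : Fin p → ℝ, l2Norm (A.mulVec v) ≤ c * l2Norm v}

/-- `vk` is a version of `v` with all but the `k` largest-magnitude entries set to zero. -/
def IsMaxK {p : ℕ} (k : ℕ) (v vk : Fin p → ℝ) : Prop :=
  ∃ T : Finset (Fin p), T.card = min k p ∧
    (∀ i ∈ T, ∀ j ∉ T, |v j| ≤ |v i|) ∧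
    vk = fun i => if i ∈ T then v i else 0


/-! ### Auxiliary lemmas -/

lemma aux_mulVec_bound {n p : ℕ} (A : Matrix (Fin n) (Fin p) ℝ) (v : Fin p → ℝ) :
    ∑ i, (A.mulVec v i) ^ 2 ≤ (∑ i, ∑ j, (A i j) ^ 2) * ∑ j, (v j) ^ 2 := by
  rw [Finset.sum_mul]
  refine Finset.sum_le_sum fun i _ => ?_
  exact Finset.sum_mul_sq_le_sq_mul_sq Finset.univ (fun j => A i j) v

lemma aux_ric_spec {n p : ℕ} (A : Matrix (Fin n) (Fin p) ℝ) (m : ℕ) :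
    0 ≤ ric A m ∧ ∀ x : Fin p → ℝ, Sparse m x →
    (1 - ric A m) * (∑ i, (x i) ^ 2) ≤ (∑ i, (A.mulVec x i) ^ 2) ∧
    (∑ i, (A.mulVec x i) ^ 2) ≤ (1 + ric A m) * (∑ i, (x i) ^ 2) := by
  have key : ric A m ∈ {δ : ℝ | 0 ≤ δ ∧ ∀ x : Fin p → ℝ, Sparse m x →
    (1 - δ) * (∑ i, (x i) ^ 2) ≤ (∑ i, (A.mulVec x i) ^ 2) ∧
    (∑ i, (A.mulVec x i) ^ 2) ≤ (1 + δ) * (∑ i, (x i) ^ 2)} := by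
    unfold ric
    apply IsClosed.csInf_mem
    · simp only [Set.ofPred_and, Set.ofPred_forall]
      refine IsClosed.inter (isClosed_le (by fun_prop) (by fun_prop)) ?_
      refine isClosed_iInter fun x => isClosed_iInter fun _ => ?_
      exact IsClosed.inter (isClosed_le (by fun_prop) (by fun_prop))
        (isClosed_le (by fun_prop) (by fun_prop))
    · refine ⟨1 + ∑ i, ∑ j, (A i j) ^ 2, by positivity, fun x _ => ?_⟩
      have h1 := aux_mulVec_bound A x
      have h2 : 0 ≤ ∑ i, ∑ j, (A i j) ^ 2 := by positivity
      have h3 : 0 ≤ ∑ i, (x i) ^ 2 := by positivity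
      have h4 : 0 ≤ ∑ i, (A.mulVec x i) ^ 2 := by positivity
      have h5 := mul_nonneg h2 h3
      constructor <;> nlinarith
    · exact ⟨0, fun d hd => hd.1⟩
  exact key

lemma aux_spec_spec {n p : ℕ} (A : Matrix (Fin n) (Fin p) ℝ) :
    0 ≤ specNorm A ∧ ∀ v : Fin p → ℝ, l2Norm (A.mulVec v) ≤ specNorm A * l2Norm v := by
  have key : specNorm A ∈
      {c : ℝ | 0 ≤ c ∧ ∀ v : Fin p → ℝ, l2Norm (A.mulVec v) ≤ c * l2Norm v} := by
    unfold specNorm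
    apply IsClosed.csInf_mem
    · simp only [Set.ofPred_and, Set.ofPred_forall]
      refine IsClosed.inter (isClosed_le (by fun_prop) (by fun_prop)) ?_
      refine isClosed_iInter fun x => ?_
      exact (isClosed_le (by fun_prop) (by fun_prop))
    · refine ⟨Real.sqrt (∑ i, ∑ j, (A i j) ^ 2), by positivity, fun x => ?_⟩
      unfold l2Norm
      rw [← Real.sqrt_mul (by positivity)]
      exact Real.sqrt_le_sqrt (aux_mulVec_bound A x)
    · exact ⟨0, fun d hd => hd.1⟩
  exact key

lemma aux_dot_le {n : ℕ} (u v : Fin n → ℝ) : |u ⬝ᵥ v| ≤ l2Norm u * l2Norm v := by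
  unfold l2Norm
  rw [← Real.sqrt_mul (by positivity)]
  exact Real.abs_le_sqrt (Finset.sum_mul_sq_le_sq_mul_sq Finset.univ u v)

lemma aux_le_linf {p : ℕ} (v : Fin p → ℝ) (i : Fin p) : |v i| ≤ linfNorm v :=
  le_ciSup (f := fun i => |v i|) (Set.finite_range _).bddAbove i

lemma aux_linf_le {p : ℕ} (v : Fin p → ℝ) (c : ℝ) (hc : 0 ≤ c) (h : ∀ i, |v i| ≤ c) :
    linfNorm v ≤ c := Real.iSup_le h hc

lemma aux_linf_nonneg {p : ℕ} (v : Fin p → ℝ) : 0 ≤ linfNorm v :=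
  Real.iSup_nonneg fun _ => abs_nonneg _

lemma aux_gram {n p : ℕ} (A : Matrix (Fin n) (Fin p) ℝ) (v : Fin p → ℝ) (j : Fin p) :
    |A.transpose.mulVec (A.mulVec v) j| ≤ specNorm A ^ 2 * l2Norm v := by
  obtain ⟨h0, h1⟩ := aux_spec_spec A
  have e : A.transpose.mulVec (A.mulVec v) j = A.mulVec (Pi.single j 1) ⬝ᵥ A.mulVec v := by
    rw [Matrix.mulVec_single_one]; rfl
  rw [e]
  have h2 := h1 (Pi.single j 1)
  have h3 : l2Norm (Pi.single j (1:ℝ) : Fin p → ℝ) = 1 := by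
    unfold l2Norm
    simp [Pi.single_apply]
  rw [h3, mul_one] at h2
  calc _ ≤ _ := aux_dot_le _ _
    _ ≤ specNorm A * (specNorm A * l2Norm v) :=
      mul_le_mul h2 (h1 v) (Real.sqrt_nonneg _) h0
    _ = _ := by ring

lemma aux_poly_pert {p : ℕ} (u : Fin p → ℝ) (i j : Fin p) (hij : i ≠ j) (e : ℝ)
    (hi : u i ≠ 0) (hj : u j ≠ 0)
    (hi1 : 0 ≤ |u i| + e) (hj1 : 0 ≤ |u j| - e) (l : Fin p) :
    |(u + e • (Pi.single i (SignType.sign (u i) : ℝ) -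
      Pi.single j (SignType.sign (u j) : ℝ) : Fin p → ℝ)) l|
      = |u l| + (Pi.single i e : Fin p → ℝ) l - (Pi.single j e : Fin p → ℝ) l := by
  have hs : ∀ a e : ℝ, a ≠ 0 → 0 ≤ |a| + e → |a + e * (SignType.sign a : ℝ)| = |a| + e := by
    intro a e ha h
    rcases lt_or_gt_of_ne ha with h1 | h1
    · rw [abs_of_neg h1] at *
      rw [sign_neg h1]
      simp only [SignType.coe_neg_one]
      rw [abs_of_nonpos (by linarith)]; ring
    · rw [abs_of_pos h1] at *
      rw [sign_pos h1]
      simp only [SignType.coe_one]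
      rw [abs_of_nonneg (by linarith)]; ring
  by_cases h1 : l = i
  · subst h1
    simp [hij, hs _ _ hi hi1]
  · by_cases h2 : l = j
    · subst h2
      have := hs (u l) (-e) hj (by linarith)
      simp [h1]
      rw [← sub_eq_add_neg] at this
      rw [← this]; congr 1; ring
    · simp [h1, h2]

lemma aux_poly_sparse {p : ℕ} (S : Finset (Fin p)) (N : ℕ) (a L : ℝ) (hL : L ≤ N * a)
    (u : Fin p → ℝ)
    (hu : u ∈ Set.extremePoints ℝ {u : Fin p → ℝ | (∀ i, i ∉ S → u i = 0) ∧ (∀ i, |u i| ≤ a) ∧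
      ∑ i, |u i| ≤ L}) : Sparse N u := by
  classical
  rw [mem_extremePoints] at hu
  obtain ⟨⟨huS, hua, huL⟩, hext⟩ := hu
  by_contra hcon
  unfold Sparse l0 at hcon
  push Not at hcon
  set F := Finset.univ.filter (fun i => u i ≠ 0 ∧ |u i| < a) with hF
  set B := Finset.univ.filter (fun i => u i ≠ 0 ∧ ¬ |u i| < a) with hB
  have hcard : F.card + B.card = (Finset.univ.filter (fun i => u i ≠ 0)).card := by
    rw [hF, hB, ← Finset.filter_filter, ← Finset.filter_filter]
    exact Finset.card_filter_add_card_filter_not _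
  have hapos : 0 < a := by
    have : 0 < (Finset.univ.filter (fun i => u i ≠ 0)).card := by
      convert lt_of_le_of_lt (Nat.zero_le _) hcon
    obtain ⟨i, hi⟩ := Finset.card_pos.mp this
    exact lt_of_lt_of_le (abs_pos.mpr (Finset.mem_filter.mp hi).2) (hua i)
  have hdisj : Disjoint F B := by
    rw [Finset.disjoint_left]
    intro i h1 h2
    exact (Finset.mem_filter.mp h2).2.2 (Finset.mem_filter.mp h1).2.2
  have hsum : ∑ i ∈ F, |u i| + B.card * a ≤ L := by
    have h1 : ∑ i ∈ B, |u i| = B.card * a := by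
      rw [← nsmul_eq_mul]
      apply Finset.sum_eq_card_nsmul
      intro i hi
      exact le_antisymm (hua i) (not_lt.mp (Finset.mem_filter.mp hi).2.2)
    rw [← h1, ← Finset.sum_union hdisj]
    exact (Finset.sum_le_sum_of_subset_of_nonneg (Finset.subset_univ _)
      (fun _ _ _ => abs_nonneg _)).trans huL
  have hc2 : N < F.card + B.card := by rw [hcard]; convert hcon
  have hF2 : 1 < F.card := by
    by_contra hF1
    have hBN : (N:ℝ) ≤ B.card := by exact_mod_cast (by omega : N ≤ B.card)
    rcases Nat.eq_zero_or_pos F.card with h0 | h0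
    · have : (N:ℝ) + 1 ≤ B.card := by exact_mod_cast (by omega : N + 1 ≤ B.card)
      have h3 : 0 ≤ ∑ i ∈ F, |u i| := Finset.sum_nonneg fun _ _ => abs_nonneg _
      nlinarith
    · have h3 : 0 < ∑ i ∈ F, |u i| := Finset.sum_pos
        (fun i hi => abs_pos.mpr (Finset.mem_filter.mp hi).2.1) (Finset.card_pos.mp h0)
      nlinarith
  obtain ⟨i, hi, j, hj, hij⟩ := Finset.one_lt_card.mp hF2
  have hi' := (Finset.mem_filter.mp hi).2
  have hj' := (Finset.mem_filter.mp hj).2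
  obtain ⟨e, he, he1, he2, he3, he4⟩ : ∃ e : ℝ, 0 < e ∧ e ≤ |u i| ∧ e ≤ |u j| ∧
      e ≤ a - |u i| ∧ e ≤ a - |u j| := by
    refine ⟨min (min |u i| |u j|) (min (a - |u i|) (a - |u j|)), ?_, ?_, ?_, ?_, ?_⟩
    · simp only [lt_min_iff]
      exact ⟨⟨abs_pos.mpr hi'.1, abs_pos.mpr hj'.1⟩, by linarith, by linarith⟩
    all_goals simp
  set d : Fin p → ℝ :=
    Pi.single i (SignType.sign (u i) : ℝ) - Pi.single j (SignType.sign (u j) : ℝ) with hd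
  have hmem : ∀ e' : ℝ, |e'| ≤ e → u + e' • d ∈ {u : Fin p → ℝ | (∀ i, i ∉ S → u i = 0) ∧
      (∀ i, |u i| ≤ a) ∧ ∑ i, |u i| ≤ L} := by
    intro e' he'
    obtain ⟨g1, g2⟩ := abs_le.mp he'
    have hp := aux_poly_pert u i j hij e' hi'.1 hj'.1 (by linarith) (by linarith)
    rw [← hd] at hp
    refine ⟨?_, ?_, ?_⟩
    · intro l hl
      have hli : l ≠ i := fun h => hi'.1 (huS i (h ▸ hl))
      have hlj : l ≠ j := fun h => hj'.1 (huS j (h ▸ hl))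
      simp [hd, hli, hlj, huS l hl]
    · intro l
      rw [hp]
      by_cases h1 : l = i
      · subst h1; simp [hij]; linarith
      · by_cases h2 : l = j
        · subst h2; simp [h1]; linarith
        · simp [h1, h2, hua l]
    · rw [Finset.sum_congr rfl fun l _ => hp l, Finset.sum_sub_distrib, Finset.sum_add_distrib]
      simpa using huL
  have := (hext (u + e • d) (hmem e (by rw [abs_of_pos he])) (u + (-e) • d)
    (hmem (-e) (by rw [abs_neg, abs_of_pos he]))
    ⟨1/2, 1/2, by norm_num, by norm_num, by norm_num, by
      ext l; simp; ring⟩).1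
  have h2 := congrFun this i
  simp [hd, hij] at h2
  rcases h2 with h2 | h2
  · exact he.ne' h2
  · rcases lt_or_gt_of_ne hi'.1 with h3 | h3
    · simp [sign_neg h3] at h2
    · simp [sign_pos h3] at h2

lemma aux_poly {p : ℕ} (S : Finset (Fin p)) (N : ℕ) (a L : ℝ) (hL : L ≤ N * a)
    (w : Fin p → ℝ) (C : ℝ)
    (h : ∀ u : Fin p → ℝ, (∀ i, i ∉ S → u i = 0) → (∀ i, |u i| ≤ a) → ∑ i, |u i| ≤ L →
      Sparse N u → C ≤ w ⬝ᵥ u)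
    (v : Fin p → ℝ) (hv1 : ∀ i, i ∉ S → v i = 0) (hv2 : ∀ i, |v i| ≤ a)
    (hv3 : ∑ i, |v i| ≤ L) : C ≤ w ⬝ᵥ v := by
  set P := {u : Fin p → ℝ | (∀ i, i ∉ S → u i = 0) ∧ (∀ i, |u i| ≤ a) ∧
      ∑ i, |u i| ≤ L} with hP
  have hclosed : IsClosed P := by
    simp only [hP, Set.ofPred_and, Set.ofPred_forall]
    refine IsClosed.inter ?_ (IsClosed.inter ?_ ?_)
    · exact isClosed_iInter fun i => isClosed_iInter fun _ =>
        isClosed_eq (by fun_prop) (by fun_prop)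
    · exact isClosed_iInter fun i => isClosed_le (by fun_prop) (by fun_prop)
    · exact isClosed_le (by fun_prop) (by fun_prop)
  have hcomp : IsCompact P := by
    refine IsCompact.of_isClosed_subset
      (isCompact_univ_pi (s := fun _ : Fin p => Set.Icc (-a) a) fun _ => isCompact_Icc) hclosed ?_
    intro u hu i _
    exact abs_le.mp (hu.2.1 i)
  have hconv : Convex ℝ P := by
    intro u hu v hv s t hs ht hst
    have hb : ∀ i, |(s • u + t • v) i| ≤ s * |u i| + t * |v i| := by
      intro i
      simp only [Pi.add_apply, Pi.smul_apply, smul_eq_mul]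
      refine (abs_add_le _ _).trans ?_
      rw [abs_mul, abs_mul, abs_of_nonneg hs, abs_of_nonneg ht]
    refine ⟨fun i hi => by simp [hu.1 i hi, hv.1 i hi], fun i => (hb i).trans ?_,
      (Finset.sum_le_sum fun i _ => hb i).trans ?_⟩
    · have := hu.2.1 i
      have := hv.2.1 i
      have e : a = s * a + t * a := by rw [← add_mul, hst, one_mul]
      rw [e]; gcongr
    · rw [Finset.sum_add_distrib, ← Finset.mul_sum, ← Finset.mul_sum]
      have e : L = s * L + t * L := by rw [← add_mul, hst, one_mul]
      have := hu.2.2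
      have := hv.2.2
      rw [e]; gcongr
  have hKM := closure_convexHull_extremePoints hcomp hconv
  have hvP : v ∈ closure (convexHull ℝ (Set.extremePoints ℝ P)) := by
    rw [hKM]; exact ⟨hv1, hv2, hv3⟩
  have hsub : closure (convexHull ℝ (Set.extremePoints ℝ P)) ⊆ {u | C ≤ w ⬝ᵥ u} := by
    refine closure_minimal (convexHull_min ?_ ?_) ?_
    · intro u hu
      obtain ⟨h1, h2, h3⟩ := extremePoints_subset hu
      exact h u h1 h2 h3 (aux_poly_sparse S N a L hL u hu)
    · intro u hu v hv s t hs ht hst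
      simp only [Set.mem_ofPred_eq, dotProduct_add, dotProduct_smul, smul_eq_mul] at *
      have e : C = s * C + t * C := by rw [← add_mul, hst, one_mul]
      rw [e]; gcongr
    · refine isClosed_le continuous_const ?_
      exact continuous_finsetSum _ fun i _ => by fun_prop
  exact hsub hvP

lemma aux_top {p : ℕ} (f : Fin p → ℝ) (m : ℕ) (hm : m ≤ p) :
    ∃ T : Finset (Fin p), T.card = m ∧ ∀ i ∈ T, ∀ j ∉ T, f j ≤ f i := by
  classical
  induction m with
  | zero => exact ⟨∅, by simp, by simp⟩
  | succ m ih =>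
    obtain ⟨T, hT, hT2⟩ := ih (by omega)
    have hne : (Tᶜ).Nonempty := by
      rw [← Finset.card_pos, Finset.card_compl, Fintype.card_fin]; omega
    obtain ⟨a, ha, ha2⟩ := Finset.exists_max_image Tᶜ f hne
    have ha' : a ∉ T := Finset.mem_compl.mp ha
    refine ⟨insert a T, by rw [Finset.card_insert_of_notMem ha', hT], ?_⟩
    intro i hi j hj
    rw [Finset.mem_insert, not_or] at hj
    rcases Finset.mem_insert.mp hi with h | h
    · rw [h]; exact ha2 j (Finset.mem_compl.mpr hj.2)
    · exact hT2 i h j hj.2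

lemma aux_threshold {p : ℕ} (f : Fin p → ℝ) (hf : ∀ i, 0 ≤ f i) (T : Finset (Fin p))
    (hT : ∀ i ∈ T, ∀ j ∉ T, f j ≤ f i) :
    ∃ a : ℝ, 0 ≤ a ∧ (∀ i ∈ T, a ≤ f i) ∧ ∀ j ∉ T, f j ≤ a := by
  rcases T.eq_empty_or_nonempty with h | h
  · subst h
    exact ⟨∑ i, f i, Finset.sum_nonneg fun i _ => hf i, by simp,
      fun j _ => Finset.single_le_sum (fun i _ => hf i) (Finset.mem_univ j)⟩
  · obtain ⟨a, ha, ha2⟩ := Finset.exists_min_image T f h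
    exact ⟨f a, hf a, ha2, hT a ha⟩

lemma aux_exchange {p : ℕ} (f : Fin p → ℝ) (T T0 : Finset (Fin p)) (hc : T.card = T0.card)
    (a : ℝ) (h1 : ∀ i ∈ T0, a ≤ f i) (h2 : ∀ j ∉ T0, f j ≤ a) :
    ∑ i ∈ T, f i ≤ ∑ i ∈ T0, f i := by
  classical
  rw [← Finset.sum_sdiff_le_sum_sdiff]
  calc _ ≤ (T \ T0).card • a :=
        Finset.sum_le_card_nsmul _ _ _ fun i hi => h2 i (Finset.mem_sdiff.mp hi).2
    _ = (T0 \ T).card • a := by rw [Finset.card_sdiff_comm hc]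
    _ ≤ _ := Finset.card_nsmul_le_sum _ _ _ fun i hi => h1 i (Finset.mem_sdiff.mp hi).1

lemma aux_core {n p : ℕ} (A : Matrix (Fin n) (Fin p) ℝ) (m : ℕ) (h0 u : Fin p → ℝ)
    (hdisj : ∀ i, h0 i * u i = 0) (hsp : ∀ a b : ℝ, Sparse m (a • h0 + b • u))
    (r : ℝ) (hr : 0 < r) (hu : ∑ i, (u i) ^ 2 ≤ (r ^ 2 - 1) * ∑ i, (h0 i) ^ 2) :
    (1 - r * ric A m) * ∑ i, (h0 i) ^ 2 ≤ A.mulVec h0 ⬝ᵥ A.mulVec (h0 + u) := by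
  obtain ⟨hd, hR⟩ := aux_ric_spec A m
  set δ := ric A m
  have e1 : ∀ a b : ℝ, ∑ i, ((a • h0 + b • u) i) ^ 2 =
      a ^ 2 * ∑ i, (h0 i) ^ 2 + b ^ 2 * ∑ i, (u i) ^ 2 := by
    intro a b
    rw [Finset.mul_sum, Finset.mul_sum, ← Finset.sum_add_distrib]
    refine Finset.sum_congr rfl fun i _ => ?_
    simp only [Pi.add_apply, Pi.smul_apply, smul_eq_mul]
    linear_combination 2 * a * b * hdisj i
  have e2 : ∀ a b : ℝ, ∑ i, (A.mulVec (a • h0 + b • u) i) ^ 2 =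
      a ^ 2 * (A.mulVec h0 ⬝ᵥ A.mulVec h0) + 2 * a * b * (A.mulVec h0 ⬝ᵥ A.mulVec u)
        + b ^ 2 * (A.mulVec u ⬝ᵥ A.mulVec u) := by
    intro a b
    simp only [dotProduct]
    rw [Finset.mul_sum, Finset.mul_sum, Finset.mul_sum, ← Finset.sum_add_distrib,
      ← Finset.sum_add_distrib]
    refine Finset.sum_congr rfl fun i _ => ?_
    rw [Matrix.mulVec_add, Matrix.mulVec_smul, Matrix.mulVec_smul]
    simp only [Pi.add_apply, Pi.smul_apply, smul_eq_mul]
    ring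
  have g1 := (hR _ (hsp (r + 1) 1)).1
  have g2 := (hR _ (hsp (r - 1) (-1))).2
  rw [e1, e2] at g1 g2
  rw [Matrix.mulVec_add, dotProduct_add]
  have g3 := mul_le_mul_of_nonneg_left hu hd
  have : 0 ≤ (4 * r) * ((A.mulVec h0 ⬝ᵥ A.mulVec h0) + (A.mulVec h0 ⬝ᵥ A.mulVec u)
      - (1 - r * δ) * ∑ i, (h0 i) ^ 2) := by
    nlinarith
  have := nonneg_of_mul_nonneg_right this (by linarith)
  linarith

lemma aux_young (q : ℝ) (hq0 : 0 < q) (hq1 : q < 1) (a b : ℝ) (ha : 0 ≤ a) (hb : 0 ≤ b) :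
    a ^ q * b ^ (2 - q) ≤ q / 2 * a ^ 2 + (1 - q / 2) * b ^ 2 := by
  have := Real.geom_mean_le_arith_mean2_weighted (w₁ := q / 2) (w₂ := 1 - q / 2)
    (p₁ := a ^ 2) (p₂ := b ^ 2) (by linarith) (by linarith) (by positivity) (by positivity)
    (by ring)
  rw [← Real.rpow_natCast_mul ha, ← Real.rpow_natCast_mul hb] at this
  convert this using 3 <;> push_cast <;> ring

lemma aux_main {n p : ℕ} (q : ℝ) (hq0 : 0 < q) (hq1 : q < 1)
    (k : ℕ) (hk : 0 < k) (s : ℝ) (hs : 0 < s)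
    (A : Matrix (Fin n) (Fin p) ℝ) (h : Fin p → ℝ) (T : Finset (Fin p)) (hTk : T.card ≤ k)
    (hT : ∀ i ∈ T, ∀ j ∉ T, |h j| ≤ |h i|)
    (htail : ∑ i ∈ Tᶜ, |h i| ^ q ≤ ∑ i ∈ T, |h i| ^ q) (D : ℝ)
    (hD : ∀ j, |A.transpose.mulVec (A.mulVec h) j| ≤ D) (hD0 : 0 ≤ D)
    (δ : ℝ) (hδdef : δ = ric A ⌈(s ^ q + 1) * (k : ℝ)⌉₊)
    (hδ : 0 < 1 - Real.sqrt (s ^ (q - 2) + 1) * δ) :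
    l2Norm h ≤ Real.sqrt (2 * ((s ^ q + 1) * (k : ℝ))) * D /
        (1 - Real.sqrt (s ^ (q - 2) + 1) * δ) := by
  classical
  have hkR : (0:ℝ) < k := by exact_mod_cast hk
  have hsq : 0 < s ^ q := Real.rpow_pos_of_pos hs q
  set Q := ∑ i ∈ T, |h i| ^ q with hQ
  have hQ0 : 0 ≤ Q := Finset.sum_nonneg fun i _ => by positivity
  -- the tail is dominated in ℓ₂
  have hl2 : ∑ i ∈ Tᶜ, (h i) ^ 2 ≤ ∑ i ∈ T, (h i) ^ 2 := by
    obtain ⟨a, ha0, ha1, ha2⟩ := aux_threshold (fun i => |h i|) (fun i => abs_nonneg _) T hT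
    have hsplit : ∀ i, (h i) ^ 2 = |h i| ^ (2 - q) * |h i| ^ q := by
      intro i
      rw [← Real.rpow_add_of_nonneg (abs_nonneg _) (by linarith) hq0.le]
      simp
    calc ∑ i ∈ Tᶜ, (h i) ^ 2 ≤ ∑ i ∈ Tᶜ, a ^ (2 - q) * |h i| ^ q := by
          refine Finset.sum_le_sum fun i hi => ?_
          rw [hsplit]
          gcongr
          · linarith
          · exact ha2 i (Finset.mem_compl.mp hi)
      _ ≤ ∑ i ∈ T, a ^ (2 - q) * |h i| ^ q := by
          rw [← Finset.mul_sum, ← Finset.mul_sum]; gcongr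
      _ ≤ _ := by
          refine Finset.sum_le_sum fun i hi => ?_
          rw [hsplit]
          gcongr
          · linarith
          · exact ha1 i hi
  rcases hQ0.eq_or_lt with hQz | hQpos
  · -- degenerate case
    have hz : ∀ i ∈ T, (h i) ^ 2 = 0 := by
      intro i hi
      have := (Finset.sum_eq_zero_iff_of_nonneg (fun i _ => by positivity)).mp
        (hQ.symm.trans hQz.symm) i hi
      rw [Real.rpow_eq_zero (abs_nonneg _) hq0.ne', abs_eq_zero] at this
      rw [this]; ring
    have h0 : ∑ i, (h i) ^ 2 ≤ 0 := by
      rw [← Finset.sum_add_sum_compl T]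
      have := Finset.sum_eq_zero hz
      linarith
    have : l2Norm h = 0 := Real.sqrt_eq_zero'.mpr h0
    rw [this]
    positivity
  -- α
  set α := (Q / k) ^ (1 / q) with hα
  have hα0 : 0 < α := by positivity
  have hαq : α ^ q = Q / k := by
    rw [hα, ← Real.rpow_mul (by positivity), one_div_mul_cancel hq0.ne', Real.rpow_one]
  set b := α / s with hb
  have hb0 : 0 < b := by positivity
  have hbq : b ^ q * (s ^ q * k) = Q := by
    rw [hb, Real.div_rpow hα0.le hs.le, hαq]; field_simp
  have hbq0 : 0 < b ^ q := by positivity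
  set M := Tᶜ.filter (fun i => b < |h i|) with hM
  set S := Tᶜ.filter (fun i => ¬ b < |h i|) with hS
  have hMS : ∀ f : Fin p → ℝ, ∑ i ∈ M, f i + ∑ i ∈ S, f i = ∑ i ∈ Tᶜ, f i :=
    fun f => Finset.sum_filter_add_sum_filter_not _ _ _
  have hMq : (M.card : ℝ) * b ^ q ≤ ∑ i ∈ M, |h i| ^ q := by
    rw [← nsmul_eq_mul]
    refine Finset.card_nsmul_le_sum _ _ _ fun i hi => ?_
    exact Real.rpow_le_rpow hb0.le (Finset.mem_filter.mp hi).2.le hq0.le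
  have hSq : ∑ i ∈ S, |h i| ^ q ≤ (s ^ q * k - M.card) * b ^ q := by
    have := hMS (fun i => |h i| ^ q)
    nlinarith
  have hMk : (M.card : ℝ) ≤ s ^ q * k := by
    have h1 : 0 ≤ ∑ i ∈ S, |h i| ^ q := Finset.sum_nonneg fun i _ => by positivity
    have := nonneg_of_mul_nonneg_left (h1.trans hSq) hbq0
    linarith
  set L := (s ^ q * k - M.card) * b with hL
  have hS1 : ∑ i ∈ S, |h i| ≤ L := by
    calc ∑ i ∈ S, |h i| ≤ ∑ i ∈ S, b ^ (1 - q) * |h i| ^ q := by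
          refine Finset.sum_le_sum fun i hi => ?_
          have h1 : |h i| ≤ b := not_lt.mp (Finset.mem_filter.mp hi).2
          calc |h i| = |h i| ^ (1 - q) * |h i| ^ q := by
                rw [← Real.rpow_add_of_nonneg (abs_nonneg _) (by linarith) hq0.le]
                simp
            _ ≤ _ := by
                gcongr
      _ ≤ b ^ (1 - q) * ((s ^ q * k - M.card) * b ^ q) := by
          rw [← Finset.mul_sum]; gcongr
      _ = L := by
          have : b ^ (1 - q) * b ^ q = b := by
            rw [← Real.rpow_add hb0]; simp
          rw [hL]
          linear_combination (s ^ q * k - M.card) * this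
  -- power mean
  have hpm : k * α ^ 2 ≤ ∑ i ∈ T, (h i) ^ 2 := by
    have h1 : ∑ i ∈ T, |h i| ^ q * α ^ (2 - q) ≤
        ∑ i ∈ T, (q / 2 * (h i) ^ 2 + (1 - q / 2) * α ^ 2) := by
      refine Finset.sum_le_sum fun i _ => ?_
      have := aux_young q hq0 hq1 |h i| α (abs_nonneg _) hα0.le
      rwa [sq_abs] at this
    rw [← Finset.sum_mul, ← hQ, Finset.sum_add_distrib, ← Finset.mul_sum, Finset.sum_const,
      nsmul_eq_mul] at h1
    have h2 : Q = k * α ^ q := by rw [hαq]; field_simp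
    have h3 : α ^ q * α ^ (2 - q) = α ^ 2 := by
      rw [← Real.rpow_add hα0]; simp
    have h4 : (T.card : ℝ) ≤ k := by exact_mod_cast hTk
    have h5 : (T.card : ℝ) * ((1 - q / 2) * α ^ 2) ≤ k * ((1 - q / 2) * α ^ 2) := by
      have : 0 ≤ 1 - q / 2 := by linarith
      gcongr
    have h6 : Q * α ^ (2 - q) = k * α ^ 2 := by rw [h2, mul_assoc, h3]
    have h7 : 0 ≤ q / 2 * (∑ i ∈ T, (h i) ^ 2 - k * α ^ 2) := by linarith
    have := nonneg_of_mul_nonneg_right h7 (by linarith)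
    linarith
  -- splitting
  set W := T ∪ M with hW
  have hTM : Disjoint T M := by
    rw [Finset.disjoint_left]
    intro i hi hi2
    exact Finset.mem_compl.mp (Finset.mem_filter.mp hi2).1 hi
  have hWS : Wᶜ = S := by
    ext i
    simp only [hW, hM, hS, Finset.mem_compl, Finset.mem_union, Finset.mem_filter]
    tauto
  set h0 : Fin p → ℝ := fun i => if i ∈ W then h i else 0 with hh0
  set h2 : Fin p → ℝ := fun i => if i ∈ S then h i else 0 with hh2
  have hadd : h = h0 + h2 := by
    ext i
    simp only [hh0, hh2, Pi.add_apply, ← hWS, Finset.mem_compl]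
    by_cases hi : i ∈ W <;> simp [hi]
  set X2 := ∑ i, (h0 i) ^ 2 with hX2
  have hX2W : X2 = ∑ i ∈ W, (h i) ^ 2 := by
    simp [hX2, hh0, ite_pow, Finset.sum_ite_mem]
  have hX2T : ∑ i ∈ T, (h i) ^ 2 ≤ X2 := by
    rw [hX2W]
    exact Finset.sum_le_sum_of_subset_of_nonneg Finset.subset_union_left
      (fun _ _ _ => sq_nonneg _)
  have hWcard : W.card = T.card + M.card := Finset.card_union_of_disjoint hTM
  set r := Real.sqrt (s ^ (q - 2) + 1) with hr
  have hc0 : 0 < s ^ (q - 2) := by positivity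
  have hr0 : 0 < r := Real.sqrt_pos.mpr (by positivity)
  have hr2 : r ^ 2 - 1 = s ^ (q - 2) := by rw [hr, Real.sq_sqrt (by positivity)]; ring
  have hMceil : M.card ≤ ⌈s ^ q * (k:ℝ)⌉₊ := by
    exact_mod_cast hMk.trans (Nat.le_ceil _)
  have hceil : ⌈(s ^ q + 1) * (k : ℝ)⌉₊ = ⌈s ^ q * (k:ℝ)⌉₊ + k := by
    rw [add_mul, one_mul, Nat.ceil_add_natCast (by positivity)]
  set N := ⌈s ^ q * (k:ℝ)⌉₊ - M.card with hN
  have hLN : L ≤ N * b := by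
    rw [hL, hN, Nat.cast_sub hMceil]
    have := Nat.le_ceil (s ^ q * (k:ℝ))
    gcongr
  set w : Fin p → ℝ := A.transpose.mulVec (A.mulVec h0) with hw
  have hwdot : ∀ u : Fin p → ℝ, A.mulVec h0 ⬝ᵥ A.mulVec u = w ⬝ᵥ u := by
    intro u
    rw [Matrix.dotProduct_mulVec, hw, Matrix.mulVec_transpose]
  have hlow : (1 - r * δ) * X2 - w ⬝ᵥ h0 ≤ w ⬝ᵥ h2 := by
    refine aux_poly S N b L hLN w _ ?_ h2 ?_ ?_ ?_
    · intro u hu1 hu2 hu3 hu4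
      have := aux_core A ⌈(s ^ q + 1) * (k : ℝ)⌉₊ h0 u ?_ ?_ r hr0 ?_
      · rw [hwdot, dotProduct_add, ← hδdef] at this
        linarith
      · intro i
        by_cases hi : i ∈ W
        · rw [hu1 i (by rw [← hWS]; simpa using hi), mul_zero]
        · simp [hh0, hi]
      · intro a c
        unfold Sparse l0 at hu4 ⊢
        rw [hceil]
        calc _ ≤ (W ∪ Finset.univ.filter (fun i => u i ≠ 0)).card := by
              apply Finset.card_le_card
              intro i hi
              rw [Finset.mem_filter] at hi
              rw [Finset.mem_union, Finset.mem_filter]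
              by_contra hcon
              push Not at hcon
              apply hi.2
              simp [hh0, hcon.1, hcon.2 (Finset.mem_univ _)]
          _ ≤ _ := (Finset.card_union_le _ _)
          _ ≤ W.card + N := by
              gcongr
          _ ≤ _ := by omega
      · have : ∑ i, (u i) ^ 2 ≤ b * L := by
          calc ∑ i, (u i) ^ 2 ≤ ∑ i, b * |u i| := by
                refine Finset.sum_le_sum fun i _ => ?_
                rw [← sq_abs, sq]
                gcongr
                exact hu2 i
            _ ≤ b * L := by rw [← Finset.mul_sum]; gcongr
        have h3 : L ≤ s ^ q * k * b := by
          rw [hL]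
          gcongr
          have : (0:ℝ) ≤ M.card := Nat.cast_nonneg _
          linarith
        rw [hr2]
        have h4 : s ^ (q - 2) = s ^ q / s ^ 2 := by
          rw [Real.rpow_sub hs]; simp
        calc _ ≤ _ := this
          _ ≤ b * (s ^ q * k * b) := by gcongr
          _ = s ^ (q - 2) * (k * α ^ 2) := by rw [hb, h4]; field_simp
          _ ≤ _ := by
            gcongr
            exact hpm.trans hX2T
    · intro i hi; simp [hh2, hi]
    · intro i
      by_cases hi : i ∈ S
      · simp only [hh2, hi, if_true]
        exact not_lt.mp (Finset.mem_filter.mp hi).2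
      · simp [hh2, hi, hb0.le]
    · have : ∑ i, |h2 i| = ∑ i ∈ S, |h i| := by
        simp [hh2, apply_ite abs, Finset.sum_ite_mem]
      rw [this]; exact hS1
  have hlow2 : (1 - r * δ) * X2 ≤ A.mulVec h0 ⬝ᵥ A.mulVec h := by
    rw [hwdot, hadd, dotProduct_add]; linarith
  have hup : A.mulVec h0 ⬝ᵥ A.mulVec h ≤ D * ∑ i ∈ W, |h i| := by
    rw [dotProduct_comm, Matrix.dotProduct_mulVec, ← Matrix.mulVec_transpose]
    simp only [dotProduct]
    calc _ ≤ ∑ i, D * |h0 i| := by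
          refine Finset.sum_le_sum fun i _ => (le_abs_self _).trans ?_
          rw [abs_mul]
          gcongr
          exact hD i
      _ = _ := by
          rw [← Finset.mul_sum]
          simp [hh0, apply_ite abs, Finset.sum_ite_mem]
  have hWt : (W.card : ℝ) ≤ (s ^ q + 1) * k := by
    rw [hWcard]; push_cast
    have h4 : (T.card : ℝ) ≤ k := by exact_mod_cast hTk
    linarith
  have hW1 : ∑ i ∈ W, |h i| ≤ Real.sqrt ((s ^ q + 1) * k) * Real.sqrt X2 := by
    rw [← Real.sqrt_mul (by positivity)]
    apply Real.le_sqrt_of_sq_le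
    refine (sq_sum_le_card_mul_sum_sq).trans ?_
    simp only [sq_abs]
    rw [← hX2W]
    have : 0 ≤ X2 := by positivity
    gcongr
  have hX0 : 0 ≤ X2 := by positivity
  have hXpos : 0 < X2 := lt_of_lt_of_le (by positivity) (hpm.trans hX2T)
  have hXs : 0 < Real.sqrt X2 := Real.sqrt_pos.mpr hXpos
  have hfin : (1 - r * δ) * Real.sqrt X2 ≤ D * Real.sqrt ((s ^ q + 1) * k) := by
    have h1 : (1 - r * δ) * X2 ≤ D * (Real.sqrt ((s ^ q + 1) * k) * Real.sqrt X2) :=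
      hlow2.trans (hup.trans (by gcongr))
    have h2 : Real.sqrt X2 * Real.sqrt X2 = X2 := Real.mul_self_sqrt hX0
    refine le_of_mul_le_mul_right ?_ hXs
    calc _ = (1 - r * δ) * X2 := by rw [mul_assoc, h2]
      _ ≤ _ := h1
      _ = _ := by ring
  have hnorm : l2Norm h ≤ Real.sqrt 2 * Real.sqrt X2 := by
    unfold l2Norm
    rw [← Real.sqrt_mul (by norm_num)]
    apply Real.sqrt_le_sqrt
    rw [← Finset.sum_add_sum_compl T]
    linarith
  rw [le_div_iff₀ hδ, Real.sqrt_mul (by norm_num) ((s ^ q + 1) * (k:ℝ))]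
  calc l2Norm h * (1 - r * δ) ≤ (Real.sqrt 2 * Real.sqrt X2) * (1 - r * δ) := by gcongr
    _ = Real.sqrt 2 * ((1 - r * δ) * Real.sqrt X2) := by ring
    _ ≤ Real.sqrt 2 * (D * Real.sqrt ((s ^ q + 1) * k)) := by gcongr
    _ = _ := by ring

lemma aux_triangle {p : ℕ} (u v : Fin p → ℝ) : l2Norm (u + v) ≤ l2Norm u + l2Norm v := by
  have h := norm_add_le (WithLp.toLp 2 u) (WithLp.toLp 2 v)
  rw [← WithLp.toLp_add, EuclideanSpace.norm_eq, EuclideanSpace.norm_eq,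
    EuclideanSpace.norm_eq] at h
  simpa [l2Norm] using h

lemma aux_cone {p : ℕ} (q : ℝ) (hq0 : 0 < q) (hq1 : q < 1) (xk xhat : Fin p → ℝ)
    (T : Finset (Fin p)) (hxk : ∀ i ∉ T, xk i = 0) (hle : lqq q xhat ≤ lqq q xk) :
    ∑ i ∈ Tᶜ, |(xhat - xk) i| ^ q ≤ ∑ i ∈ T, |(xhat - xk) i| ^ q := by
  classical
  unfold lqq at hle
  rw [← Finset.sum_add_sum_compl T, ← Finset.sum_add_sum_compl T (fun i => |xk i| ^ q)] at hle
  have h1 : ∑ i ∈ Tᶜ, |xk i| ^ q = 0 := Finset.sum_eq_zero fun i hi => by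
    rw [hxk i (Finset.mem_compl.mp hi), abs_zero, Real.zero_rpow hq0.ne']
  have h2 : ∑ i ∈ Tᶜ, |(xhat - xk) i| ^ q = ∑ i ∈ Tᶜ, |xhat i| ^ q :=
    Finset.sum_congr rfl fun i hi => by
      rw [Pi.sub_apply, hxk i (Finset.mem_compl.mp hi), sub_zero]
  have h3 : ∑ i ∈ T, |xk i| ^ q ≤ ∑ i ∈ T, |xhat i| ^ q + ∑ i ∈ T, |(xhat - xk) i| ^ q := by
    rw [← Finset.sum_add_distrib]
    refine Finset.sum_le_sum fun i _ => ?_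
    refine le_trans ?_ (Real.rpow_add_le_add_rpow (abs_nonneg _) (abs_nonneg _) hq0.le hq1.le)
    refine Real.rpow_le_rpow (abs_nonneg _) ?_ hq0.le
    have := abs_sub_abs_le_abs_sub (xk i) (xhat i)
    rw [abs_sub_comm] at this
    rw [Pi.sub_apply]; linarith
  linarith

/-- **Theorem 3 (stable recovery under Dantzig-selector-type noise).** -/
theorem lq_stable_recovery_ds_noise {n p : ℕ} (q : ℝ) (hq0 : 0 < q) (hq1 : q < 1)
    (k : ℕ) (hk : 0 < k) (s : ℝ) (hs : 0 < s)
    (A : Matrix (Fin n) (Fin p) ℝ) (x xk xhat : Fin p → ℝ) (z : Fin n → ℝ)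
    (ε η : ℝ) (y : Fin n → ℝ)
    (hz : linfNorm (A.transpose.mulVec z) ≤ ε) (hy : y = A.mulVec x + z)
    (hxk : IsMaxK k x xk)
    (hη : ε + (specNorm A) ^ 2 * l2Norm (x - xk) ≤ η)
    (δ : ℝ) (hδdef : δ = ric A ⌈(s ^ q + 1) * (k : ℝ)⌉₊)
    (hδ : δ < 1 / Real.sqrt (s ^ (q - 2) + 1))
    (hfeas : linfNorm (A.transpose.mulVec (y - A.mulVec xhat)) ≤ η)
    (hmin : ∀ w : Fin p → ℝ,
      linfNorm (A.transpose.mulVec (y - A.mulVec w)) ≤ η → lqq q xhat ≤ lqq q w) :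
    l2Norm (xhat - x) ≤
      Real.sqrt (2 * ((s ^ q + 1) * (k : ℝ))) * (ε + η) /
        (1 - Real.sqrt (s ^ (q - 2) + 1) * δ) +
      (Real.sqrt (2 * ((s ^ q + 1) * (k : ℝ))) * (specNorm A) ^ 2 /
        (1 - Real.sqrt (s ^ (q - 2) + 1) * δ) + 1) * l2Norm (x - xk) := by
  classical
  obtain ⟨T, hTc, hTtop, hxkdef⟩ := hxk
  set σ2 := specNorm A ^ 2 * l2Norm (x - xk) with hσ
  have hσ0 : 0 ≤ σ2 := mul_nonneg (sq_nonneg _) (Real.sqrt_nonneg _)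
  have hε0 : 0 ≤ ε := (aux_linf_nonneg _).trans hz
  have hη0 : 0 ≤ η := by linarith
  have hres : ∀ j, |A.transpose.mulVec (y - A.mulVec xk) j| ≤ ε + σ2 := by
    intro j
    have e : y - A.mulVec xk = z + A.mulVec (x - xk) := by
      rw [hy, Matrix.mulVec_sub]; abel
    rw [e, Matrix.mulVec_add, Pi.add_apply]
    refine (abs_add_le _ _).trans ?_
    exact add_le_add ((aux_le_linf _ j).trans hz) (aux_gram A _ j)
  have hle : lqq q xhat ≤ lqq q xk :=
    hmin xk ((aux_linf_le _ _ (by linarith) hres).trans hη)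
  have hcone := aux_cone q hq0 hq1 xk xhat T (fun i hi => by rw [hxkdef]; simp [hi]) hle
  set h := xhat - xk with hh
  obtain ⟨T0, hT0c, hT0⟩ := aux_top (fun i => |h i|) (min k p) (min_le_right _ _)
  have htail : ∑ i ∈ T0ᶜ, |h i| ^ q ≤ ∑ i ∈ T0, |h i| ^ q := by
    obtain ⟨a, _, ha1, ha2⟩ := aux_threshold (fun i => |h i| ^ q) (fun i => by positivity) T0
      (fun i hi j hj => Real.rpow_le_rpow (abs_nonneg _) (hT0 i hi j hj) hq0.le)
    have h1 := aux_exchange (fun i => |h i| ^ q) T T0 (hTc.trans hT0c.symm) a ha1 ha2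
    have h2 := Finset.sum_add_sum_compl T (fun i => |h i| ^ q)
    have h3 := Finset.sum_add_sum_compl T0 (fun i => |h i| ^ q)
    linarith
  have hD : ∀ j, |A.transpose.mulVec (A.mulVec h) j| ≤ ε + η + σ2 := by
    intro j
    have e : A.mulVec h = (y - A.mulVec xk) - (y - A.mulVec xhat) := by
      rw [hh, Matrix.mulVec_sub]; abel
    rw [e, Matrix.mulVec_sub, Pi.sub_apply]
    refine (abs_sub _ _).trans ?_
    have := (aux_le_linf _ j).trans hfeas
    linarith [hres j]
  have hden : 0 < 1 - Real.sqrt (s ^ (q - 2) + 1) * δ := by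
    have : 0 < Real.sqrt (s ^ (q - 2) + 1) := Real.sqrt_pos.mpr (by positivity)
    rw [lt_div_iff₀ this] at hδ
    linarith
  have hmain := aux_main q hq0 hq1 k hk s hs A h T0 (hT0c.le.trans (min_le_left _ _)) hT0 htail
    (ε + η + σ2) hD (by linarith) δ hδdef hden
  have htri : l2Norm (xhat - x) ≤ l2Norm h + l2Norm (x - xk) := by
    have e : xhat - x = h + (xk - x) := by rw [hh]; abel
    have e2 : l2Norm (x - xk) = l2Norm (xk - x) := by
      unfold l2Norm
      congr 1
      exact Finset.sum_congr rfl fun i _ => by simp only [Pi.sub_apply]; ring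
    rw [e, e2]
    exact aux_triangle _ _
  refine htri.trans ((add_le_add_left hmain _).trans (le_of_eq ?_))
  rw [hσ]; ring
end

section
/- Let 0 < q < 1, let k be a positive integer, let s > 0, let ρ ≥ 0, and let A ∈ ℝ^{n×p} whose ⌈(s^q+1)k⌉-order restricted isometry constant δ = δ_{(s^q+1)k} satisfies δ < 1/√(s^{q-2}+1). Let h ∈ ℝ^p satisfy the cone condition ‖h_{-max(k)}‖_q^q ≤ ‖h_{max(k)}‖_q^q, and suppose that ⟨Aw, Ah⟩ ≤ ρ·‖w‖_2 for every ⌈(s^q+1)k⌉-sparse vector w ∈ ℝ^p whose support is contained in supp(h) ∪ supp(h_{max(k)}). Then ‖h‖_2 ≤ √2·ρ/(1 − √(s^{q-2}+1)·δ). -/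
open scoped BigOperators

/-- Linear functionals over the capped simplex are bounded by their values on vertices. -/
theorem aux_greedy {ι : Type*} [DecidableEq ι] (P : Finset ι) (c x : ι → ℝ) (r : ℕ) (b : ℝ)
    (hx0 : ∀ j ∈ P, 0 ≤ x j) (hx1 : ∀ j ∈ P, x j ≤ 1) (hsum : ∑ j ∈ P, x j ≤ r)
    (hS : ∀ S ⊆ P, S.card ≤ r → ∑ j ∈ S, c j ≤ b) : ∑ j ∈ P, c j * x j ≤ b := by
  obtain ⟨S, hSm, hSmax⟩ := Finset.exists_max_image (P.powerset.filter (fun S => S.card ≤ r))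
    (fun S => ∑ j ∈ S, c j) ⟨∅, by simp⟩
  simp only [Finset.mem_filter, Finset.mem_powerset] at hSm hSmax
  obtain ⟨hSP, hSr⟩ := hSm
  refine le_trans ?_ (hS S hSP hSr)
  have hpos : ∀ i ∈ S, 0 ≤ c i := by
    intro i hi
    have := hSmax (S.erase i) ⟨(Finset.erase_subset _ _).trans hSP,
      (Finset.card_le_card (Finset.erase_subset _ _)).trans hSr⟩
    have h2 := Finset.add_sum_erase S c hi
    linarith
  obtain ⟨τ, hτ0, hτS, hτP, hτr⟩ : ∃ τ : ℝ, 0 ≤ τ ∧ (∀ i ∈ S, τ ≤ c i) ∧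
      (∀ j ∈ P \ S, c j ≤ τ) ∧ τ * r ≤ τ * S.card := by
    rcases hSr.lt_or_eq with hlt | heq
    · refine ⟨0, le_rfl, hpos, ?_, by simp⟩
      intro j hj
      rw [Finset.mem_sdiff] at hj
      have := hSmax (insert j S) ⟨Finset.insert_subset hj.1 hSP, by
        rw [Finset.card_insert_of_notMem hj.2]; omega⟩
      rw [Finset.sum_insert hj.2] at this
      linarith
    · rcases S.eq_empty_or_nonempty with he | hne
      · subst he
        simp at heq
        subst heq
        refine ⟨∑ j ∈ P, |c j|, Finset.sum_nonneg (fun _ _ => abs_nonneg _), by simp, ?_, by simp⟩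
        intro j hj
        have hj' : j ∈ P := by simpa using hj
        exact (le_abs_self _).trans
          (Finset.single_le_sum (f := fun j => |c j|) (fun _ _ => abs_nonneg _) hj')
      · obtain ⟨i0, hi0, hmin⟩ := Finset.exists_min_image S c hne
        refine ⟨c i0, hpos _ hi0, hmin, ?_, by rw [heq]⟩
        intro j hj
        rw [Finset.mem_sdiff] at hj
        have hj' : j ∉ S.erase i0 := fun h => hj.2 (Finset.mem_of_mem_erase h)
        have := hSmax (insert j (S.erase i0)) ⟨Finset.insert_subset hj.1
          ((Finset.erase_subset _ _).trans hSP), by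
            rw [Finset.card_insert_of_notMem hj', Finset.card_erase_of_mem hi0]
            have := Finset.card_pos.2 hne
            omega⟩
        rw [Finset.sum_insert hj'] at this
        have h2 := Finset.add_sum_erase S c hi0
        linarith
  have e1 := Finset.sum_sdiff hSP (f := fun j => c j * x j)
  have e2 := Finset.sum_sdiff hSP (f := fun j => x j)
  have f1 : ∑ j ∈ P \ S, c j * x j ≤ τ * ∑ j ∈ P \ S, x j := by
    rw [Finset.mul_sum]
    exact Finset.sum_le_sum fun j hj =>
      mul_le_mul_of_nonneg_right (hτP j hj) (hx0 j (Finset.mem_sdiff.1 hj).1)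
  have f2 : ∑ j ∈ S, c j * x j ≤ ∑ j ∈ S, (c j - τ + τ * x j) := by
    refine Finset.sum_le_sum fun j hj => ?_
    nlinarith [mul_nonneg (sub_nonneg.2 (hτS j hj)) (sub_nonneg.2 (hx1 j (hSP hj)))]
  rw [Finset.sum_add_distrib, Finset.sum_sub_distrib, ← Finset.mul_sum, Finset.sum_const,
    nsmul_eq_mul] at f2
  nlinarith [mul_le_mul_of_nonneg_left hsum hτ0]

theorem aux_ric_nonempty {n p : ℕ} (A : Matrix (Fin n) (Fin p) ℝ) (m : ℕ) :
    {δ : ℝ | 0 ≤ δ ∧ ∀ x : Fin p → ℝ, Sparse m x →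
    (1 - δ) * (∑ i, (x i) ^ 2) ≤ (∑ i, (A.mulVec x i) ^ 2) ∧
    (∑ i, (A.mulVec x i) ^ 2) ≤ (1 + δ) * (∑ i, (x i) ^ 2)}.Nonempty := by
  have hC : 0 ≤ ∑ i, ∑ j, (A i j) ^ 2 :=
    Finset.sum_nonneg fun _ _ => Finset.sum_nonneg fun _ _ => sq_nonneg _
  refine ⟨1 + ∑ i, ∑ j, (A i j) ^ 2, by linarith, ?_⟩
  intro x _
  have hx : 0 ≤ ∑ i, (x i) ^ 2 := Finset.sum_nonneg fun _ _ => sq_nonneg _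
  have hA : 0 ≤ ∑ i, (A.mulVec x i) ^ 2 := Finset.sum_nonneg fun _ _ => sq_nonneg _
  have hb : ∑ i, (A.mulVec x i) ^ 2 ≤ (∑ i, ∑ j, (A i j) ^ 2) * ∑ i, (x i) ^ 2 := by
    rw [Finset.sum_mul]
    refine Finset.sum_le_sum fun i _ => ?_
    simpa [Matrix.mulVec, dotProduct] using
      Finset.sum_mul_sq_le_sq_mul_sq Finset.univ (fun j => A i j) x
  constructor <;> nlinarith [mul_nonneg hC hx]

theorem aux_ric_nonneg {n p : ℕ} (A : Matrix (Fin n) (Fin p) ℝ) (m : ℕ) : 0 ≤ ric A m :=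
  Real.sInf_nonneg fun _ h => h.1

theorem aux_ric {n p : ℕ} (A : Matrix (Fin n) (Fin p) ℝ) (m : ℕ) (x : Fin p → ℝ)
    (hx : Sparse m x) :
    (1 - ric A m) * (∑ i, (x i) ^ 2) ≤ (∑ i, (A.mulVec x i) ^ 2) ∧
    (∑ i, (A.mulVec x i) ^ 2) ≤ (1 + ric A m) * (∑ i, (x i) ^ 2) := by
  have hX : 0 ≤ ∑ i, (x i) ^ 2 := Finset.sum_nonneg fun _ _ => sq_nonneg _
  have key : ∀ ε > 0, ∃ d, d < ric A m + ε ∧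
      (1 - d) * (∑ i, (x i) ^ 2) ≤ (∑ i, (A.mulVec x i) ^ 2) ∧
      (∑ i, (A.mulVec x i) ^ 2) ≤ (1 + d) * (∑ i, (x i) ^ 2) := by
    intro ε hε
    obtain ⟨d, hd, hlt⟩ := Real.lt_sInf_add_pos (aux_ric_nonempty A m) hε
    exact ⟨d, hlt, hd.2 x hx⟩
  have key2 : ∀ ε > 0, (1 - ric A m) * (∑ i, (x i) ^ 2) ≤ (∑ i, (A.mulVec x i) ^ 2) + ε ∧
      (∑ i, (A.mulVec x i) ^ 2) ≤ (1 + ric A m) * (∑ i, (x i) ^ 2) + ε := by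
    intro ε hε
    obtain ⟨d, hlt, h1, h2⟩ := key (ε / (∑ i, (x i) ^ 2 + 1)) (by positivity)
    have h3 : ε / (∑ i, (x i) ^ 2 + 1) * (∑ i, (x i) ^ 2) ≤ ε := by
      rw [div_mul_eq_mul_div, div_le_iff₀ (by positivity)]
      nlinarith
    have h4 := mul_le_mul_of_nonneg_right hlt.le hX
    constructor <;> nlinarith
  exact ⟨le_of_forall_pos_le_add fun ε hε => (key2 ε hε).1,
    le_of_forall_pos_le_add fun ε hε => (key2 ε hε).2⟩

/-- power mean inequality -/
theorem aux_power_mean {ι : Type*} (T : Finset ι) (y : ι → ℝ) (q : ℝ) (hq0 : 0 < q) (hq1 : q < 1)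
    (k : ℕ) (hT : T.card ≤ k) (hy : ∀ i ∈ T, 0 ≤ y i) (hsum : ∑ i ∈ T, (y i) ^ 2 = k) :
    ∑ i ∈ T, (y i) ^ q ≤ k := by
  have h1 : ∀ i ∈ T, (y i) ^ q ≤ (1 - q / 2) + q / 2 * (y i) ^ 2 := by
    intro i hi
    have := rpow_one_add_le_one_add_mul_self (s := (y i) ^ 2 - 1) (p := q / 2)
      (by nlinarith [sq_nonneg (y i)]) (by linarith) (by linarith)
    have e : (1 + ((y i) ^ 2 - 1)) ^ (q / 2) = (y i) ^ q := by
      rw [add_sub_cancel, ← Real.rpow_natCast, ← Real.rpow_mul (hy i hi)]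
      congr 1; push_cast; ring
    rw [e] at this
    linarith
  have h2 := Finset.sum_le_sum h1
  rw [Finset.sum_add_distrib, ← Finset.mul_sum, hsum, Finset.sum_const, nsmul_eq_mul] at h2
  have : (T.card : ℝ) ≤ k := by exact_mod_cast hT
  nlinarith

/-- tail ℓ₂ bound -/
theorem aux_tail {p : ℕ} (T : Finset (Fin p)) (h : Fin p → ℝ) (q : ℝ) (hq0 : 0 < q) (hq1 : q < 1)
    (hord : ∀ i ∈ T, ∀ j ∉ T, |h j| ≤ |h i|)
    (hcone : ∑ j ∈ Tᶜ, |h j| ^ q ≤ ∑ j ∈ T, |h j| ^ q) :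
    ∑ j ∈ Tᶜ, (h j) ^ 2 ≤ ∑ j ∈ T, (h j) ^ 2 := by
  have sp : ∀ i, (h i) ^ 2 = |h i| ^ q * |h i| ^ (2 - q) := by
    intro i
    rw [← Real.rpow_add_of_nonneg (abs_nonneg _) hq0.le (by linarith)]
    simp
  rcases T.eq_empty_or_nonempty with he | hne
  · subst he
    simp only [Finset.sum_empty] at hcone ⊢
    have h0 := (Finset.sum_eq_zero_iff_of_nonneg (fun i _ => Real.rpow_nonneg (abs_nonneg (h i)) q)).1
      (le_antisymm hcone (Finset.sum_nonneg fun i _ => Real.rpow_nonneg (abs_nonneg (h i)) q))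
    refine (Finset.sum_eq_zero fun i hi => ?_).le
    rw [sp, h0 i hi, zero_mul]
  · obtain ⟨i0, hi0, hmin⟩ := Finset.exists_min_image T (fun i => |h i|) hne
    have h1 : ∑ j ∈ Tᶜ, (h j) ^ 2 ≤ (∑ j ∈ Tᶜ, |h j| ^ q) * |h i0| ^ (2 - q) := by
      rw [Finset.sum_mul]
      refine Finset.sum_le_sum fun j hj => ?_
      rw [sp]
      have := hord i0 hi0 j (Finset.mem_compl.1 hj)
      gcongr
      linarith
    have h2 : (∑ j ∈ T, |h j| ^ q) * |h i0| ^ (2 - q) ≤ ∑ j ∈ T, (h j) ^ 2 := by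
      rw [Finset.sum_mul]
      refine Finset.sum_le_sum fun j hj => ?_
      rw [sp j]
      have := hmin j hj
      gcongr
      linarith
    exact h1.trans ((mul_le_mul_of_nonneg_right hcone (Real.rpow_nonneg (abs_nonneg _) _)).trans h2)

/-- the averaged RIP inequality -/
theorem aux_core_s12 {n p : ℕ} (A : Matrix (Fin n) (Fin p) ℝ) (N r : ℕ) (δ : ℝ) (hδ0 : 0 ≤ δ)
    (hrip : ∀ x : Fin p → ℝ, Sparse N x →
      (1 - δ) * (∑ i, (x i) ^ 2) ≤ (∑ i, (A.mulVec x i) ^ 2) ∧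
      (∑ i, (A.mulVec x i) ^ 2) ≤ (1 + δ) * (∑ i, (x i) ^ 2))
    (V P : Finset (Fin p)) (hVP : Disjoint V P) (hcard : V.card + r ≤ N)
    (h v : Fin p → ℝ) (hv : v = fun i => if i ∈ V then h i else 0)
    (hh : ∀ i, i ∉ V → i ∉ P → h i = 0) (hP0 : ∀ i ∈ P, h i ≠ 0)
    (a : ℝ) (ha : 0 < a) (hPa : ∀ i ∈ P, |h i| ≤ a) (hsum : ∑ i ∈ P, |h i| / a ≤ r)
    (μ : ℝ) :
    (μ - μ ^ 2) * (∑ i, (v i) ^ 2) - δ * ((1 / 4 + (1 / 2 - μ) ^ 2) * (∑ i, (v i) ^ 2)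
      + μ ^ 2 / 2 * (a ^ 2 * ∑ i ∈ P, |h i| / a)) ≤
    (μ - μ ^ 2) * ∑ j, A.mulVec v j * A.mulVec h j := by
  classical
  set G : Fin p → ℝ := fun i => ∑ j, A.mulVec v j * A j i with hG
  have hGw : ∀ w : Fin p → ℝ, ∑ j, A.mulVec v j * A.mulVec w j = ∑ i, w i * G i := by
    intro w
    simp only [hG, Finset.mul_sum]
    rw [Finset.sum_comm]
    refine Finset.sum_congr rfl fun j _ => ?_
    have e : A.mulVec w j = ∑ i, A j i * w i := rfl
    rw [e, Finset.mul_sum]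
    exact Finset.sum_congr rfl fun i _ => by ring
  set X := ∑ i, (v i) ^ 2 with hX
  set VV := ∑ j, A.mulVec v j * A.mulVec v j with hVV
  set sg : Fin p → ℝ := fun i => SignType.sign (h i) with hsg
  have hsg2 : ∀ i ∈ P, sg i ^ 2 = 1 := by
    intro i hi
    rcases lt_or_gt_of_ne (hP0 i hi) with h1 | h1 <;> simp [hsg, h1]
  have hsga : ∀ i, sg i * |h i| = h i := fun i => sign_mul_abs (h i)
  have main := aux_greedy P (fun i => -(δ * (μ ^ 2 / 2) * a ^ 2) - (μ - μ ^ 2) * (a * sg i * G i))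
    (fun i => |h i| / a) r ((μ - μ ^ 2) * VV - (μ - μ ^ 2) * X
      + δ * ((1 / 4 + (1 / 2 - μ) ^ 2) * X))
    (fun i _ => by positivity) (fun i hi => by rw [div_le_one ha]; exact hPa i hi) hsum ?_
  · have e1 : ∑ i ∈ P, h i * G i + VV = ∑ j, A.mulVec v j * A.mulVec h j := by
      rw [hVV, hGw, hGw, ← Finset.sum_filter_add_sum_filter_not Finset.univ (· ∈ P) (fun i => h i * G i)]
      congr 1
      · congr 1; ext; simp
      · rw [← Finset.sum_filter_add_sum_filter_not Finset.univ (· ∈ P) (fun i => v i * G i)]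
        rw [Finset.sum_eq_zero, zero_add]
        · refine Finset.sum_congr rfl fun i hi => ?_
          have : i ∉ P := by simpa using hi
          rw [hv]
          simp only
          split_ifs with hiV
          · rfl
          · rw [hh i hiV this]
        · intro i hi
          have hi : i ∈ P := by simpa using hi
          have := Finset.disjoint_right.1 hVP hi
          simp [hv, this]
    have e2 : ∑ i ∈ P, (-(δ * (μ ^ 2 / 2) * a ^ 2) - (μ - μ ^ 2) * (a * sg i * G i)) * (|h i| / a)
        = -(δ * (μ ^ 2 / 2) * a ^ 2) * ∑ i ∈ P, |h i| / a - (μ - μ ^ 2) * ∑ i ∈ P, h i * G i := by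
      rw [Finset.mul_sum, Finset.mul_sum, ← Finset.sum_sub_distrib]
      refine Finset.sum_congr rfl fun i _ => ?_
      rw [sub_mul]
      congr 1
      rw [← hsga i]
      have := hsga i
      field_simp
      rw [hsga i]
    rw [e2] at main
    rw [← e1]
    linarith
  · intro S hSP hSr
    set u : Fin p → ℝ := fun i => if i ∈ S then a * sg i else 0 with hu
    have hu2 : ∑ i, (u i) ^ 2 = a ^ 2 * S.card := by
      have : ∀ i, (u i) ^ 2 = if i ∈ S then a ^ 2 else 0 := by
        intro i
        simp only [hu]
        split_ifs with hi
        · rw [mul_pow, hsg2 i (hSP hi), mul_one]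
        · simp
      simp only [this]
      rw [Finset.sum_ite_mem, Finset.univ_inter, Finset.sum_const, nsmul_eq_mul, mul_comm]
    have huv : ∀ i, v i * u i = 0 := by
      intro i
      simp only [hu, hv]
      by_cases hi : i ∈ S
      · have := Finset.disjoint_right.1 hVP (hSP hi)
        simp [this]
      · simp [hi]
    have hsp : ∀ c d : ℝ, Sparse N (c • v + d • u) := by
      intro c d
      unfold Sparse l0
      refine le_trans (Finset.card_le_card (t := V ∪ S) ?_)
        ((Finset.card_union_le _ _).trans (by omega))
      intro i hi
      by_contra hn
      simp only [Finset.mem_union, not_or] at hn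
      simp [hu, hv, hn.1, hn.2] at hi
    have hnorm : ∀ c d : ℝ, ∑ i, ((c • v + d • u) i) ^ 2 = c ^ 2 * X + d ^ 2 * (a ^ 2 * S.card) := by
      intro c d
      rw [hX, ← hu2, Finset.mul_sum, Finset.mul_sum, ← Finset.sum_add_distrib]
      refine Finset.sum_congr rfl fun i _ => ?_
      simp only [Pi.add_apply, Pi.smul_apply, smul_eq_mul]
      linear_combination 2 * c * d * huv i
    have hAn : ∀ c d : ℝ, ∑ i, (A.mulVec (c • v + d • u) i) ^ 2 =
        c ^ 2 * VV + 2 * c * d * (∑ j, A.mulVec v j * A.mulVec u j)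
          + d ^ 2 * ∑ j, (A.mulVec u j) ^ 2 := by
      intro c d
      rw [hVV, Finset.mul_sum, Finset.mul_sum, Finset.mul_sum, ← Finset.sum_add_distrib,
        ← Finset.sum_add_distrib]
      refine Finset.sum_congr rfl fun i _ => ?_
      rw [Matrix.mulVec_add, Matrix.mulVec_smul, Matrix.mulVec_smul]
      simp only [Pi.add_apply, Pi.smul_apply, smul_eq_mul]
      ring
    have r1 := (hrip _ (hsp 1 μ)).2
    have r1' := (hrip _ (hsp 1 μ)).1
    have r2 := (hrip _ (hsp (1 / 2 - μ) (-(μ / 2)))).2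
    rw [hnorm, hAn] at r1' r2
    have e3 : ∑ j, A.mulVec v j * A.mulVec u j = ∑ i ∈ S, a * sg i * G i := by
      rw [hGw]
      simp only [hu, ite_mul, zero_mul]
      rw [Finset.sum_ite_mem, Finset.univ_inter]
    rw [e3] at r1' r2
    rw [Finset.sum_sub_distrib, ← Finset.mul_sum, Finset.sum_const, nsmul_eq_mul]
    linarith

set_option maxHeartbeats 1000000 in
/-- **Main estimate of the proof.** Under the RIC condition, the cone condition, and the
inner-product bound `⟨Aw, Ah⟩ ≤ ρ‖w‖₂` for all suitably supported sparse `w`, one has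
`‖h‖₂ ≤ √2 ρ / (1 - √(s^(q-2)+1) δ)`. -/
theorem main_l2_estimate {n p : ℕ} (q : ℝ) (hq0 : 0 < q) (hq1 : q < 1)
    (k : ℕ) (hk : 0 < k) (s ρ : ℝ) (hs : 0 < s) (hρ : 0 ≤ ρ)
    (A : Matrix (Fin n) (Fin p) ℝ)
    (δ : ℝ) (hδdef : δ = ric A ⌈(s ^ q + 1) * (k : ℝ)⌉₊)
    (hδ : δ < 1 / Real.sqrt (s ^ (q - 2) + 1))
    (h hmaxk : Fin p → ℝ) (hmax : IsMaxK k h hmaxk)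
    (hcone : lqq q (h - hmaxk) ≤ lqq q hmaxk)
    (hip : ∀ w : Fin p → ℝ, Sparse ⌈(s ^ q + 1) * (k : ℝ)⌉₊ w →
      (∀ i, w i ≠ 0 → (h i ≠ 0 ∨ hmaxk i ≠ 0)) →
      (∑ j, A.mulVec w j * A.mulVec h j) ≤ ρ * l2Norm w) :
    l2Norm h ≤ Real.sqrt 2 * ρ / (1 - Real.sqrt (s ^ (q - 2) + 1) * δ) := by
  classical
  obtain ⟨T, hTcard, hord, hmk⟩ := hmax
  have hTk : T.card ≤ k := by rw [hTcard]; exact min_le_left _ _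
  have hδ0 : 0 ≤ δ := hδdef ▸ aux_ric_nonneg _ _
  set N := ⌈(s ^ q + 1) * (k : ℝ)⌉₊ with hN
  have hsq : 0 < s ^ q := Real.rpow_pos_of_pos hs q
  have hB : 0 < s ^ (q - 2) := Real.rpow_pos_of_pos hs _
  set B := s ^ (q - 2) with hBdef
  set c := Real.sqrt (B + 1) with hc
  have hc2 : c ^ 2 = B + 1 := Real.sq_sqrt (by linarith)
  have hc0 : 0 < c := Real.sqrt_pos.2 (by linarith)
  have hden : 0 < 1 - c * δ := by
    rw [lt_div_iff₀ hc0] at hδ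
    linarith
  have hNk : N = ⌈s ^ q * (k : ℝ)⌉₊ + k := by
    rw [hN, add_mul, one_mul, Nat.ceil_add_natCast (by positivity)]
  have hq0' : (0 : ℝ) ^ q = 0 := Real.zero_rpow hq0.ne'
  have hcone' : ∑ j ∈ Tᶜ, |h j| ^ q ≤ ∑ j ∈ T, |h j| ^ q := by
    have e1 : lqq q hmaxk = ∑ j ∈ T, |h j| ^ q := by
      unfold lqq
      rw [← Finset.sum_add_sum_compl T, Finset.sum_eq_zero (s := Tᶜ), add_zero]
      · refine Finset.sum_congr rfl fun i hi => ?_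
        simp [hmk, hi]
      · intro i hi
        have := Finset.mem_compl.1 hi
        simp [hmk, this, hq0']
    have e2 : lqq q (h - hmaxk) = ∑ j ∈ Tᶜ, |h j| ^ q := by
      unfold lqq
      rw [← Finset.sum_add_sum_compl T, Finset.sum_eq_zero (s := T), zero_add]
      · refine Finset.sum_congr rfl fun i hi => ?_
        have := Finset.mem_compl.1 hi
        simp [hmk, this]
      · intro i hi
        simp [hmk, hi, hq0']
    rw [e1, e2] at hcone
    exact hcone
  have htail := aux_tail T h q hq0 hq1 hord hcone'
  have hsplit : ∑ i, (h i) ^ 2 = ∑ j ∈ T, (h j) ^ 2 + ∑ j ∈ Tᶜ, (h j) ^ 2 :=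
    (Finset.sum_add_sum_compl T _).symm
  set H := ∑ j ∈ T, (h j) ^ 2 with hH
  have hH0 : 0 ≤ H := Finset.sum_nonneg fun _ _ => sq_nonneg _
  -- it suffices to bound the head
  suffices hhead : Real.sqrt H ≤ ρ / (1 - c * δ) by
    unfold l2Norm
    calc Real.sqrt (∑ i, (h i) ^ 2) ≤ Real.sqrt (2 * H) := Real.sqrt_le_sqrt (by linarith)
      _ = Real.sqrt 2 * Real.sqrt H := Real.sqrt_mul (by norm_num) _
      _ ≤ Real.sqrt 2 * (ρ / (1 - c * δ)) := by gcongr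
      _ = _ := by ring
  rcases hH0.eq_or_lt with hz | hHpos
  · rw [← hz, Real.sqrt_zero]
    positivity
  have hkR : (0 : ℝ) < k := by exact_mod_cast hk
  set e := Real.sqrt (H / k) with he
  have he0 : 0 < e := Real.sqrt_pos.2 (by positivity)
  have he2 : e ^ 2 = H / k := Real.sq_sqrt (by positivity)
  set a := e / s with ha
  have ha0 : 0 < a := by positivity
  have hpm : ∑ i ∈ T, (|h i| / e) ^ q ≤ k := by
    refine aux_power_mean T _ q hq0 hq1 k hTk (fun i _ => by positivity) ?_
    simp only [div_pow, sq_abs]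
    rw [← Finset.sum_div, he2, ← hH]
    field_simp
  have hTc : ∑ j ∈ Tᶜ, (|h j| / a) ^ q ≤ s ^ q * k := by
    have e1 : ∀ j, (|h j| / a) ^ q = s ^ q * (|h j| ^ q / e ^ q) := by
      intro j
      rw [← Real.div_rpow (abs_nonneg _) he0.le, ← Real.mul_rpow hs.le (by positivity)]
      congr 1
      rw [ha]; field_simp
    simp only [e1]
    rw [← Finset.mul_sum, ← Finset.sum_div]
    refine mul_le_mul_of_nonneg_left ?_ hsq.le
    refine le_trans (div_le_div_of_nonneg_right hcone' (by positivity)) ?_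
    rw [Finset.sum_div]
    refine le_trans (le_of_eq ?_) hpm
    exact Finset.sum_congr rfl fun i _ => (Real.div_rpow (abs_nonneg _) he0.le _).symm
  set M := Tᶜ.filter (fun j => a < |h j|) with hM
  set P := (Tᶜ.filter (fun j => ¬ a < |h j|)).filter (fun j => h j ≠ 0) with hP
  have hcount : (M.card : ℝ) + ∑ j ∈ P, |h j| / a ≤ s ^ q * k := by
    refine le_trans ?_ hTc
    rw [← Finset.sum_filter_add_sum_filter_not Tᶜ (fun j => a < |h j|)]
    refine add_le_add ?_ ?_
    · rw [← hM, ← nsmul_one, ← Finset.sum_const]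
      refine Finset.sum_le_sum fun j hj => ?_
      have hj := (Finset.mem_filter.1 hj).2
      exact Real.one_le_rpow ((one_le_div ha0).2 hj.le) hq0.le
    · refine le_trans (Finset.sum_le_sum_of_subset_of_nonneg (Finset.filter_subset _ _)
        (fun i _ _ => by positivity)) ?_
      refine Finset.sum_le_sum fun j hj => ?_
      have hj := not_lt.1 (Finset.mem_filter.1 hj).2
      exact Real.self_le_rpow_of_le_one (by positivity) ((div_le_one ha0).2 hj) hq1.le
  have hxs0 : 0 ≤ ∑ j ∈ P, |h j| / a := Finset.sum_nonneg fun _ _ => by positivity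
  have hceil := Nat.le_ceil (s ^ q * (k : ℝ))
  have hMle : M.card ≤ ⌈s ^ q * (k : ℝ)⌉₊ := by
    have : (M.card : ℝ) ≤ (⌈s ^ q * (k : ℝ)⌉₊ : ℝ) := by linarith
    exact_mod_cast this
  obtain ⟨r, hr⟩ := Nat.exists_eq_add_of_le hMle
  have hsum : ∑ j ∈ P, |h j| / a ≤ r := by
    rw [hr] at hceil
    push_cast at hceil
    linarith
  have hTM : Disjoint T M := by
    rw [Finset.disjoint_left]
    intro i hi hi'
    simp [hM, hi] at hi'
  set v : Fin p → ℝ := fun i => if i ∈ T ∪ M then h i else 0 with hv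
  have hVcard : (T ∪ M).card + r ≤ N := by
    have := Finset.card_union_le T M
    omega
  set μ := 1 / (1 + c) with hμ
  have core := aux_core_s12 A N r δ hδ0 (by rw [hδdef]; exact fun x hx => aux_ric A N x hx) (T ∪ M) P
    (by
      rw [Finset.disjoint_left]
      intro i hi hi'
      simp only [hP, hM, Finset.mem_union, Finset.mem_filter, Finset.mem_compl] at hi hi'
      tauto) hVcard h v hv
    (by
      intro i hi hi'
      simp only [hP, hM, Finset.mem_union, Finset.mem_filter, Finset.mem_compl] at hi hi'
      tauto)
    (fun i hi => (Finset.mem_filter.1 hi).2) a ha0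
    (fun i hi => not_lt.1 (Finset.mem_filter.1 (Finset.mem_filter.1 hi).1).2) hsum μ
  have hipv := hip v
    (by
      unfold Sparse l0
      refine le_trans (Finset.card_le_card (t := T ∪ M) ?_) (by omega)
      intro i hi
      by_contra hn
      simp [hv] at hi
      simp at hn
      tauto)
    (by
      intro i hi
      left
      intro h0
      simp [hv, h0] at hi)
  have hHX : H ≤ ∑ i, (v i) ^ 2 := by
    have : H = ∑ i ∈ T, (v i) ^ 2 := by
      refine Finset.sum_congr rfl fun i hi => ?_
      simp [hv, hi]
    rw [this]
    exact Finset.sum_le_sum_of_subset_of_nonneg (Finset.subset_univ _) (fun _ _ _ => sq_nonneg _)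
  have hl2 : (l2Norm v) ^ 2 = ∑ i, (v i) ^ 2 :=
    Real.sq_sqrt (Finset.sum_nonneg fun _ _ => sq_nonneg _)
  have hHl : Real.sqrt H ≤ l2Norm v := Real.sqrt_le_sqrt hHX
  refine hHl.trans ?_
  have hY0 : 0 < l2Norm v := lt_of_lt_of_le (Real.sqrt_pos.2 hHpos) hHl
  set Y := l2Norm v with hY
  rw [← hl2] at core hHX
  have hBa : a ^ 2 * ∑ j ∈ P, |h j| / a ≤ B * Y ^ 2 := by
    have h1 : a ^ 2 * ∑ j ∈ P, |h j| / a ≤ a ^ 2 * (s ^ q * k) := by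
      refine mul_le_mul_of_nonneg_left ?_ (sq_nonneg _)
      have : (0 : ℝ) ≤ M.card := Nat.cast_nonneg _
      linarith
    have h2 : a ^ 2 * (s ^ q * k) = B * H := by
      rw [hBdef, Real.rpow_sub hs, ha, div_pow, he2, Real.rpow_two]
      field_simp
    rw [h2] at h1
    exact h1.trans (mul_le_mul_of_nonneg_left hHX hB.le)
  have hμe : μ - μ ^ 2 = c / (1 + c) ^ 2 := by
    rw [hμ]; field_simp; ring
  have hμpos : 0 < μ - μ ^ 2 := by rw [hμe]; positivity
  have hμc : 1 / 4 + (1 / 2 - μ) ^ 2 + μ ^ 2 / 2 * B = c * (μ - μ ^ 2) := by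
    have : B = c ^ 2 - 1 := by linarith
    rw [this, hμ]
    field_simp
    ring
  have h5 : δ * (μ ^ 2 / 2 * (a ^ 2 * ∑ j ∈ P, |h j| / a)) ≤ δ * (μ ^ 2 / 2 * (B * Y ^ 2)) := by
    gcongr
  have h6 := mul_le_mul_of_nonneg_left hipv hμpos.le
  have h7 : (μ - μ ^ 2) * Y * (Y * (1 - c * δ)) ≤ (μ - μ ^ 2) * Y * ρ := by
    have : δ * ((1 / 4 + (1 / 2 - μ) ^ 2) * Y ^ 2) + δ * (μ ^ 2 / 2 * (B * Y ^ 2))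
        = δ * Y ^ 2 * (c * (μ - μ ^ 2)) := by rw [← hμc]; ring
    linarith
  rw [le_div_iff₀ hden]
  exact le_of_mul_le_mul_left h7 (by positivity)
end
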